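/- Let N ≥ 1 be an integer, let ρ_N be the unscaled GSE eigenvalue density, and define u(t) = ∫_ℝ e^{t·x}·ρ_N(x) dx (the integral converges for every real t). Then u is smooth and satisfies, for every real t, the fourth order linear differential equation t·u''''(t) + 5·u'''(t) − t·((5/4)·t² + 8N + 2)·u''(t) − (9t² + 20N + 5)·u'(t) + t·((1/4)·t⁴ + 5·(N + 1/4)·t² + 16N² + 8N − 11)·u(t) = 0. -/

import Mathlib

open Nat MeasureTheory

/-- The physicists' Hermite polynomials, via the recurrence
`H_0 = 1`, `H_1 = 2x`, `H_{n+2}(x) = 2x·H_{n+1}(x) − 2(n+1)·H_n(x)`. -/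
def Hphys : ℕ → ℝ → ℝ
  | 0 => fun _ => 1
  | 1 => fun x => 2 * x
  | n + 2 => fun x => 2 * x * Hphys (n + 1) x - 2 * ((n : ℝ) + 1) * Hphys n x

/-- `Q_n(x) = ∫_{−∞}^{x} e^{−t²/2} H_n(t) dt`. -/
noncomputable def Qfun (n : ℕ) (x : ℝ) : ℝ :=
  ∫ t in Set.Iic x, Real.exp (-t ^ 2 / 2) * Hphys n t

/-- `B_N = √π·2^{2N+1}·(2N−1)!`. -/
noncomputable def Bconst (N : ℕ) : ℝ :=
  Real.sqrt Real.pi * 2 ^ (2 * N + 1) * ((2 * N - 1)! : ℝ)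

/-- The (unscaled) GSE eigenvalue density
`ρ_N(x) = B_N⁻¹(e^{−x²}(H_{2N}'H_{2N−1} − H_{2N}H_{2N−1}') + e^{−x²/2}H_{2N}Q_{2N−1})`. -/
noncomputable def gseDensity (N : ℕ) (x : ℝ) : ℝ :=
  (Bconst N)⁻¹ *
    (Real.exp (-x ^ 2) *
        (deriv (Hphys (2 * N)) x * Hphys (2 * N - 1) x -
          Hphys (2 * N) x * deriv (Hphys (2 * N - 1)) x) +
      Real.exp (-x ^ 2 / 2) * Hphys (2 * N) x * Qfun (2 * N - 1) x)

/-- The exponential generating function `u(t) = ∫_ℝ e^{tx} ρ_N(x) dx` of the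
GSE moments. -/
noncomputable def gseEGF (N : ℕ) (t : ℝ) : ℝ :=
  ∫ x : ℝ, Real.exp (t * x) * gseDensity N x

/-- Integrability of `f` against every real exponential. -/
def ExpIntegrable (f : ℝ → ℝ) : Prop :=
  ∀ t : ℝ, Integrable fun x => Real.exp (t * x) * f x

/-- The two-sided Laplace transform, with the sign convention of a moment generating function. -/
noncomputable def expTransform (f : ℝ → ℝ) (t : ℝ) : ℝ :=
  ∫ x, Real.exp (t * x) * f x

namespace ExpIntegrable

variable {f g : ℝ → ℝ}

lemma integrable (hf : ExpIntegrable f) : Integrable f := by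
  simpa using hf 0

lemma add (hf : ExpIntegrable f) (hg : ExpIntegrable g) :
    ExpIntegrable fun x => f x + g x := fun t => by
  simp only [mul_add]
  exact (hf t).add (hg t)

lemma const_mul (c : ℝ) (hf : ExpIntegrable f) : ExpIntegrable fun x => c * f x := fun t => by
  simpa only [mul_left_comm] using (hf t).const_mul c

lemma sum {ι : Type*} (s : Finset ι) {F : ι → ℝ → ℝ} (h : ∀ i ∈ s, ExpIntegrable (F i)) :
    ExpIntegrable fun x => ∑ i ∈ s, F i x := fun t => by
  simpa only [Finset.mul_sum] using integrable_finsetSum s fun i hi => h i hi t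

lemma bounded_mul {C : ℝ} (hg : Continuous g) (hC : ∀ x, |g x| ≤ C) (hf : ExpIntegrable f) :
    ExpIntegrable fun x => g x * f x := fun t => by
  simpa only [mul_left_comm] using
    (hf t).bdd_mul hg.aestronglyMeasurable (Filter.Eventually.of_forall hC)

lemma id_mul (hf : ExpIntegrable f) : ExpIntegrable fun x => x * f x := fun t => by
  refine Integrable.mono ((hf (t + 1)).norm.add (hf (t - 1)).norm) ?_ ?_
  · simp only [mul_left_comm _ (_ : ℝ) (f _)]
    exact continuous_id.aestronglyMeasurable.mul (hf t).aestronglyMeasurable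
  · refine Filter.Eventually.of_forall fun x => ?_
    have hx : |x| ≤ Real.exp x + Real.exp (-x) := by
      have h1 := Real.add_one_le_exp x
      have h2 := Real.add_one_le_exp (-x)
      have h3 := Real.exp_pos x
      have h4 := Real.exp_pos (-x)
      rw [abs_le]
      constructor <;> linarith
    have e1 : Real.exp ((t + 1) * x) = Real.exp (t * x) * Real.exp x := by
      rw [← Real.exp_add]; ring_nf
    have e2 : Real.exp ((t - 1) * x) = Real.exp (t * x) * Real.exp (-x) := by
      rw [← Real.exp_add]; ring_nf
    simp only [Pi.add_apply, Real.norm_eq_abs, abs_mul, Real.abs_exp]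
    rw [e1, e2, abs_of_nonneg (add_nonneg (by positivity) (by positivity) : 0 ≤
      Real.exp (t * x) * Real.exp x * |f x| + Real.exp (t * x) * Real.exp (-x) * |f x|)]
    calc Real.exp (t * x) * (|x| * |f x|)
        = |x| * (Real.exp (t * x) * |f x|) := by ring
      _ ≤ (Real.exp x + Real.exp (-x)) * (Real.exp (t * x) * |f x|) := by gcongr
      _ = _ := by ring

lemma polynomial_mul (hf : ExpIntegrable f) (p : Polynomial ℝ) :
    ExpIntegrable fun x => p.eval x * f x := by
  induction p using Polynomial.induction_on' with
  | add p q hp hq => simpa only [Polynomial.eval_add, add_mul] using hp.add hq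
  | monomial n a =>
    induction n with
    | zero => simpa using hf.const_mul a
    | succ n ih =>
      convert ih.id_mul using 2 with x
      simp only [Polynomial.eval_monomial]
      ring

lemma hermite_mul (hf : ExpIntegrable f) (n : ℕ) :
    ExpIntegrable fun x => Hphys n x * f x := by
  induction n using Nat.twoStepInduction with
  | zero => simpa [Hphys] using hf
  | one => simpa [Hphys, mul_assoc] using hf.id_mul.const_mul 2
  | more n h0 h1 =>
    convert (h1.id_mul.const_mul 2).add (h0.const_mul (-(2 * ((n : ℝ) + 1)))) using 2 with x
    simp only [Hphys]
    ring

lemma gaussian {b : ℝ} (hb : 0 < b) : ExpIntegrable fun x => Real.exp (-b * x ^ 2) := fun t => by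
  have h := (integrable_exp_neg_mul_sq hb).comp_sub_right (t / (2 * b))
  refine (h.const_mul (Real.exp (t ^ 2 / (4 * b)))).congr (Filter.Eventually.of_forall fun x => ?_)
  simp only
  rw [← Real.exp_add, ← Real.exp_add]
  congr 1
  field_simp
  ring

lemma expTransform_add (hf : ExpIntegrable f) (hg : ExpIntegrable g) (t : ℝ) :
    expTransform (fun x => f x + g x) t = expTransform f t + expTransform g t := by
  simp only [expTransform, mul_add]
  exact integral_add (hf t) (hg t)

lemma hasDerivAt_expTransform (hf : ExpIntegrable f) (t : ℝ) :
    HasDerivAt (expTransform f) (expTransform (fun x => x * f x) t) t := by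
  have hx := hf.id_mul
  refine (hasDerivAt_integral_of_dominated_loc_of_deriv_le
    (F := fun s x => Real.exp (s * x) * f x)
    (F' := fun s x => Real.exp (s * x) * (x * f x))
    (bound := fun x => ‖Real.exp ((t + 1) * x) * (x * f x)‖ +
      ‖Real.exp ((t - 1) * x) * (x * f x)‖)
    (Metric.ball_mem_nhds t one_pos)
    (Filter.Eventually.of_forall fun s => (hf s).aestronglyMeasurable) (hf t)
    (hx t).aestronglyMeasurable (Filter.Eventually.of_forall fun x s hs => ?_)
    ((hx (t + 1)).norm.add (hx (t - 1)).norm)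
    (Filter.Eventually.of_forall fun x s _ => ?_)).2
  · rw [Metric.mem_ball, Real.dist_eq, abs_lt] at hs
    simp only [norm_mul, Real.norm_eq_abs, Real.abs_exp, ← add_mul]
    gcongr
    rcases le_total 0 x with h | h
    · have : Real.exp (s * x) ≤ Real.exp ((t + 1) * x) :=
        Real.exp_le_exp.2 (mul_le_mul_of_nonneg_right (by linarith) h)
      linarith [Real.exp_pos ((t - 1) * x)]
    · have : Real.exp (s * x) ≤ Real.exp ((t - 1) * x) :=
        Real.exp_le_exp.2 (mul_le_mul_of_nonpos_right (by linarith) h)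
      linarith [Real.exp_pos ((t + 1) * x)]
  · exact (((hasDerivAt_id s).mul_const x).exp.mul_const (f x)).congr_deriv
      (by simp only [id]; ring)

lemma deriv_expTransform (hf : ExpIntegrable f) :
    deriv (expTransform f) = expTransform fun x => x * f x :=
  funext fun t => (hf.hasDerivAt_expTransform t).deriv

lemma iteratedDeriv_expTransform (hf : ExpIntegrable f) (n : ℕ) :
    iteratedDeriv n (expTransform f) = expTransform fun x => x ^ n * f x := by
  induction n generalizing f with
  | zero => simp
  | succ n ih =>
    rw [iteratedDeriv_succ', hf.deriv_expTransform, ih hf.id_mul]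
    simp only [pow_succ, mul_assoc]

lemma contDiff_expTransform (hf : ExpIntegrable f) :
    ContDiff ℝ (⊤ : ℕ∞) (expTransform f) := by
  refine contDiff_of_differentiable_iteratedDeriv fun n _ => ?_
  rw [hf.iteratedDeriv_expTransform n]
  intro t
  have h := hf.polynomial_mul (Polynomial.X ^ n)
  simp only [Polynomial.eval_pow, Polynomial.eval_X] at h
  exact (h.hasDerivAt_expTransform t).differentiableAt

lemma mul_expTransform (hf : ExpIntegrable f) (hg : ExpIntegrable g)
    (h : ∀ x, HasDerivAt f (g x) x) (t : ℝ) :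
    t * expTransform f t = -expTransform g t := by
  have key := integral_eq_zero_of_hasDerivAt_of_integrable
    (f := fun x => Real.exp (t * x) * f x)
    (f' := fun x => Real.exp (t * x) * (t * f x) + Real.exp (t * x) * g x)
    (fun x => (((hasDerivAt_id x).const_mul t).exp.mul (h x)).congr_deriv
      (by simp only [id]; ring))
    ((hf.const_mul t t).add (hg t)) (hf t)
  rw [integral_add (hf.const_mul t t) (hg t)] at key
  simp only [mul_left_comm _ t, integral_const_mul] at key
  simp only [expTransform]
  linarith

end ExpIntegrable

lemma expTransform_const_mul (c : ℝ) (f : ℝ → ℝ) (t : ℝ) :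
    expTransform (fun x => c * f x) t = c * expTransform f t := by
  simp only [expTransform, mul_left_comm _ c, integral_const_mul]

section Hermite

lemma hasDerivAt_Hphys_succ (n : ℕ) (x : ℝ) :
    HasDerivAt (Hphys (n + 1)) (2 * ((n : ℝ) + 1) * Hphys n x) x := by
  induction n using Nat.twoStepInduction with
  | zero => simpa [Hphys] using (hasDerivAt_id x).const_mul 2
  | one =>
    have h := (((hasDerivAt_id x).const_mul 2).mul ((hasDerivAt_id x).const_mul 2)).sub_const 2
    refine HasDerivAt.congr_deriv (f := Hphys 2) (h.congr_of_eventuallyEq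
      (Filter.Eventually.of_forall fun y => ?_)) ?_
    · simp [Hphys]
    · simp [Hphys]; ring
  | more n h0 h1 =>
    have h := (((hasDerivAt_id x).const_mul 2).mul h1).sub
      (h0.const_mul (2 * (((n + 1 : ℕ) : ℝ) + 1)))
    refine h.congr_deriv ?_
    simp only [id, Hphys]
    push_cast
    ring

lemma hasDerivAt_Hphys (n : ℕ) (x : ℝ) :
    HasDerivAt (Hphys n) (2 * x * Hphys n x - Hphys (n + 1) x) x := by
  cases n with
  | zero => simpa [Hphys] using hasDerivAt_const x (1 : ℝ)
  | succ n =>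
    convert hasDerivAt_Hphys_succ n x using 1
    simp only [Hphys]
    ring

/-- The Hermite function `e^{-x²/2} H_n(x)`, not normalized. -/
noncomputable def hermiteFun (n : ℕ) (x : ℝ) : ℝ :=
  Real.exp (-x ^ 2 / 2) * Hphys n x

lemma hasDerivAt_exp_neg_sq_div_two (x : ℝ) :
    HasDerivAt (fun x : ℝ => Real.exp (-x ^ 2 / 2)) (-x * Real.exp (-x ^ 2 / 2)) x := by
  refine (((hasDerivAt_id x).pow 2).neg.div_const 2).exp.congr_deriv ?_
  simp
  ring

lemma hasDerivAt_hermiteFun (n : ℕ) (x : ℝ) :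
    HasDerivAt (hermiteFun n) (x * hermiteFun n x - hermiteFun (n + 1) x) x := by
  refine ((hasDerivAt_exp_neg_sq_div_two x).mul (hasDerivAt_Hphys n x)).congr_deriv ?_
  simp only [hermiteFun]
  ring

lemma hasDerivAt_hermiteFun_succ (n : ℕ) (x : ℝ) :
    HasDerivAt (hermiteFun (n + 1))
      (-x * hermiteFun (n + 1) x + 2 * ((n : ℝ) + 1) * hermiteFun n x) x := by
  refine ((hasDerivAt_exp_neg_sq_div_two x).mul (hasDerivAt_Hphys_succ n x)).congr_deriv ?_
  simp only [hermiteFun]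
  ring

lemma continuous_hermiteFun (n : ℕ) : Continuous (hermiteFun n) :=
  continuous_iff_continuousAt.2 fun x => (hasDerivAt_hermiteFun n x).continuousAt

lemma expIntegrable_hermiteFun (n : ℕ) : ExpIntegrable (hermiteFun n) := by
  convert (ExpIntegrable.gaussian (b := 1 / 2) (by norm_num)).hermite_mul n using 2 with x
  rw [hermiteFun, mul_comm]
  ring_nf

lemma expIntegrable_hermiteFun_mul (m n : ℕ) :
    ExpIntegrable fun x => hermiteFun m x * hermiteFun n x := by
  convert ((ExpIntegrable.gaussian one_pos).hermite_mul m).hermite_mul n using 2 with x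
  have h : Real.exp (-1 * x ^ 2) = Real.exp (-x ^ 2 / 2) * Real.exp (-x ^ 2 / 2) := by
    rw [← Real.exp_add]; ring_nf
  rw [h, hermiteFun, hermiteFun]
  ring

lemma hasDerivAt_Qfun (n : ℕ) (x : ℝ) : HasDerivAt (Qfun n) (hermiteFun n x) x := by
  have hi := (expIntegrable_hermiteFun n).integrable
  have hQ : Qfun n = fun y => Qfun n 0 + ∫ t in (0 : ℝ)..y, hermiteFun n t := by
    funext y
    rw [← intervalIntegral.integral_Iic_sub_Iic hi.integrableOn hi.integrableOn]
    simp only [Qfun, hermiteFun]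
    ring
  rw [hQ]
  exact (intervalIntegral.integral_hasDerivAt_right hi.intervalIntegrable
    ((continuous_hermiteFun n).stronglyMeasurableAtFilter _ _)
    (continuous_hermiteFun n).continuousAt).const_add _

lemma abs_Qfun_le (n : ℕ) (x : ℝ) : |Qfun n x| ≤ ∫ t, |hermiteFun n t| := by
  have hi := (expIntegrable_hermiteFun n).integrable.abs
  exact (abs_integral_le_integral_abs).trans
    (setIntegral_le_integral hi (Filter.Eventually.of_forall fun _ => abs_nonneg _))

lemma expIntegrable_hermiteFun_mul_Qfun (m n : ℕ) :
    ExpIntegrable fun x => hermiteFun m x * Qfun n x := by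
  have hc : Continuous (Qfun n) :=
    continuous_iff_continuousAt.2 fun x => (hasDerivAt_Qfun n x).continuousAt
  simpa only [mul_comm] using (expIntegrable_hermiteFun m).bounded_mul hc (abs_Qfun_le n)

end Hermite

section DifferentialModule

open Polynomial

/-- The products of consecutive Hermite functions and of the primitive `Qfun n` through which
all derivatives of the density are expressed. -/
noncomputable def hermiteProducts (n : ℕ) : Fin 5 → ℝ → ℝ :=
  ![fun x => hermiteFun (n + 1) x * hermiteFun (n + 1) x,
    fun x => hermiteFun (n + 1) x * hermiteFun n x,
    fun x => hermiteFun n x * hermiteFun n x,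
    fun x => hermiteFun (n + 1) x * Qfun n x,
    fun x => hermiteFun n x * Qfun n x]

/-- The combination of `hermiteProducts n` with polynomial coefficients `p`. -/
noncomputable def hermiteComb (n : ℕ) (p : Fin 5 → ℝ[X]) (x : ℝ) : ℝ :=
  ∑ i, (p i).eval x * hermiteProducts n i x

/-- The coefficients of the derivative of `hermiteComb n p`. -/
noncomputable def hermiteDerivation (n : ℕ) (p : Fin 5 → ℝ[X]) : Fin 5 → ℝ[X] :=
  ![derivative (p 0) - 2 * X * p 0 - p 1,
    derivative (p 1) + 4 * ((n : ℝ[X]) + 1) * p 0 - 2 * p 2 + p 3,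
    derivative (p 2) + 2 * X * p 2 + 2 * ((n : ℝ[X]) + 1) * p 1 + p 4,
    derivative (p 3) - X * p 3 - p 4,
    derivative (p 4) + X * p 4 + 2 * ((n : ℝ[X]) + 1) * p 3]

lemma expIntegrable_hermiteComb (n : ℕ) (p : Fin 5 → ℝ[X]) :
    ExpIntegrable (hermiteComb n p) := by
  refine ExpIntegrable.sum _ fun i _ => ExpIntegrable.polynomial_mul ?_ _
  fin_cases i
  · exact expIntegrable_hermiteFun_mul _ _
  · exact expIntegrable_hermiteFun_mul _ _
  · exact expIntegrable_hermiteFun_mul _ _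
  · exact expIntegrable_hermiteFun_mul_Qfun _ _
  · exact expIntegrable_hermiteFun_mul_Qfun _ _

lemma hasDerivAt_hermiteComb (n : ℕ) (p : Fin 5 → ℝ[X]) (x : ℝ) :
    HasDerivAt (hermiteComb n p) (hermiteComb n (hermiteDerivation n p) x) x := by
  have ha := hasDerivAt_hermiteFun_succ n x
  have hb := hasDerivAt_hermiteFun n x
  have hq := hasDerivAt_Qfun n x
  have h := ((((((p 0).hasDerivAt x).mul (ha.mul ha)).add
    (((p 1).hasDerivAt x).mul (ha.mul hb))).add
    (((p 2).hasDerivAt x).mul (hb.mul hb))).add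
    (((p 3).hasDerivAt x).mul (ha.mul hq))).add
    (((p 4).hasDerivAt x).mul (hb.mul hq))
  refine (h.congr_of_eventuallyEq (Filter.Eventually.of_forall fun y => ?_)).congr_deriv ?_
  · simp [hermiteComb, hermiteProducts, Fin.sum_univ_five]
  · simp [hermiteComb, hermiteProducts, hermiteDerivation, Fin.sum_univ_five]
    ring

/-- The transform of `hermiteComb n p` at `t`, as a linear functional of `p`. -/
noncomputable def hermiteTransform (n : ℕ) (t : ℝ) : (Fin 5 → ℝ[X]) →ₗ[ℝ] ℝ where
  toFun p := expTransform (hermiteComb n p) t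
  map_add' p q := by
    rw [← (expIntegrable_hermiteComb n p).expTransform_add (expIntegrable_hermiteComb n q)]
    congr 1
    funext x
    simp only [hermiteComb, Pi.add_apply, eval_add, add_mul, Finset.sum_add_distrib]
  map_smul' c p := by
    rw [RingHom.id_apply, smul_eq_mul, ← expTransform_const_mul]
    congr 1
    funext x
    simp only [hermiteComb, Pi.smul_apply, eval_smul, smul_eq_mul, mul_assoc, Finset.mul_sum]

lemma mul_hermiteTransform (n : ℕ) (t : ℝ) (p : Fin 5 → ℝ[X]) :
    t * hermiteTransform n t p = -hermiteTransform n t (hermiteDerivation n p) :=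
  (expIntegrable_hermiteComb n p).mul_expTransform (expIntegrable_hermiteComb n _)
    (hasDerivAt_hermiteComb n p) t

lemma iteratedDeriv_hermiteTransform (n j : ℕ) (p : Fin 5 → ℝ[X]) (t : ℝ) :
    iteratedDeriv j (fun s => hermiteTransform n s p) t =
      hermiteTransform n t ((X ^ j : ℝ[X]) • p) := by
  change iteratedDeriv j (expTransform (hermiteComb n p)) t = expTransform _ t
  rw [(expIntegrable_hermiteComb n p).iteratedDeriv_expTransform]
  congr 1
  funext x
  simp [hermiteComb, Finset.mul_sum, mul_assoc]

/-- The coefficients of `B_N ρ_N`, for `n = 2N - 1`. -/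
noncomputable def densityCoeff (n : ℕ) : Fin 5 → ℝ[X] :=
  ![1, -2 * X, 2 * ((n : ℝ[X]) + 1), 1, 0]

lemma hermiteComb_densityCoeff (n : ℕ) (x : ℝ) :
    hermiteComb n (densityCoeff n) x =
      Real.exp (-x ^ 2) * (deriv (Hphys (n + 1)) x * Hphys n x -
        Hphys (n + 1) x * deriv (Hphys n) x) +
      Real.exp (-x ^ 2 / 2) * Hphys (n + 1) x * Qfun n x := by
  have h : Real.exp (-x ^ 2) = Real.exp (-x ^ 2 / 2) * Real.exp (-x ^ 2 / 2) := by
    rw [← Real.exp_add]; ring_nf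
  rw [(hasDerivAt_Hphys_succ n x).deriv, (hasDerivAt_Hphys n x).deriv, h]
  simp [hermiteComb, hermiteProducts, densityCoeff, hermiteFun, Fin.sum_univ_five]
  ring

set_option maxHeartbeats 1600000 in
lemma hermiteTransform_ode (n : ℕ) (t : ℝ) :
    t * (4 * hermiteTransform n t ((X ^ 4 : ℝ[X]) • densityCoeff n)) +
      20 * hermiteTransform n t ((X ^ 3 : ℝ[X]) • densityCoeff n) -
      t * (5 * t ^ 2 + 16 * ((n : ℝ) + 1) + 8) *
        hermiteTransform n t ((X ^ 2 : ℝ[X]) • densityCoeff n) -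
      (36 * t ^ 2 + 40 * ((n : ℝ) + 1) + 20) *
        hermiteTransform n t ((X : ℝ[X]) • densityCoeff n) +
      t * (t ^ 4 + (10 * ((n : ℝ) + 1) + 5) * t ^ 2 + 16 * ((n : ℝ) + 1) ^ 2 +
        16 * ((n : ℝ) + 1) - 44) * hermiteTransform n t (densityCoeff n) = 0 := by
  set L := hermiteTransform n t
  set D := hermiteDerivation n with hD
  set r := densityCoeff n with hr
  set k : ℝ := (n : ℝ) + 1 with hk
  let m : ℝ[X] := (n : ℝ[X]) + 1
  have hC : C k = (n : ℝ[X]) + 1 := by simp [hk]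
  have hm (j : ℕ) : derivative (((n : ℝ[X]) + 1) ^ j) = 0 := by simp [derivative_pow]
  let g₁ : Fin 5 → ℝ[X] := ![0, 1, 0, X, -2 * m]
  let g₂ : Fin 5 → ℝ[X] := ![6 + 10 * m - 5 * X ^ 2, 10 * X ^ 3 - 20 * m * X - 11 * X,
    10 * m + 20 * m ^ 2 - 10 * m * X ^ 2, 4 + 8 * m - 4 * X ^ 2, 0]
  let g₃ : Fin 5 → ℝ[X] := ![-25 * X, 7 + 8 * m + 46 * X ^ 2, -50 * m * X,
    8 * m * X - 24 * X - 4 * X ^ 3, 8 * m * X ^ 2 - 8 * m - 16 * m ^ 2]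
  let g₄ : Fin 5 → ℝ[X] :=
    ![4 * X ^ 4 - 16 * m * X ^ 2 - 12 * X ^ 2 + 16 * m ^ 2 + 24 * m - 12,
      20 * X - 40 * m * X - 32 * m ^ 2 * X + 20 * X ^ 3 + 32 * m * X ^ 3 - 8 * X ^ 5,
      32 * m ^ 3 + 32 * m ^ 2 - 44 * m - 32 * m ^ 2 * X ^ 2 - 16 * m * X ^ 2 + 8 * m * X ^ 4,
      -20 - 20 * X ^ 2, 40 * m * X]
  have h₁ : D r = -g₁ := by
    funext i
    fin_cases i <;> simp [hD, hr, g₁, m, densityCoeff, hermiteDerivation] <;> ring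
  have h₂ : D g₁ = (10 * k + 5) • r - (5 : ℝ) • (X ^ 2 : ℝ[X]) • r - g₂ := by
    funext i
    fin_cases i <;>
      simp [hD, hr, g₁, g₂, m, densityCoeff, hermiteDerivation, smul_eq_C_mul, hC,
        map_ofNat (C : ℝ →+* ℝ[X])] <;> ring
  have h₃ : D g₂ = -((36 : ℝ) • (X : ℝ[X]) • r) - g₃ := by
    funext i
    fin_cases i <;>
      simp [hD, hr, g₂, g₃, m, densityCoeff, hermiteDerivation, smul_eq_C_mul, hm,
        map_ofNat (C : ℝ →+* ℝ[X])] <;> ring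
  have h₄ : D g₃ = (4 : ℝ) • (X ^ 4 : ℝ[X]) • r - (16 * k + 8) • (X ^ 2 : ℝ[X]) • r +
      (16 * k ^ 2 + 16 * k - 44) • r - g₄ := by
    funext i
    fin_cases i <;>
      simp [hD, hr, g₃, g₄, m, densityCoeff, hermiteDerivation, smul_eq_C_mul, hC, hm,
        map_ofNat (C : ℝ →+* ℝ[X])] <;> ring
  have h₅ : D g₄ = (20 : ℝ) • (X ^ 3 : ℝ[X]) • r - (40 * k + 20) • (X : ℝ[X]) • r := by
    funext i
    fin_cases i <;>
      simp [hD, hr, g₄, m, densityCoeff, hermiteDerivation, smul_eq_C_mul, hC, hm,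
        map_ofNat (C : ℝ →+* ℝ[X])] <;> ring
  have e₁ := mul_hermiteTransform n t r
  have e₂ := mul_hermiteTransform n t g₁
  have e₃ := mul_hermiteTransform n t g₂
  have e₄ := mul_hermiteTransform n t g₃
  have e₅ := mul_hermiteTransform n t g₄
  rw [← hD] at e₁ e₂ e₃ e₄ e₅
  rw [h₁] at e₁
  rw [h₂] at e₂
  rw [h₃] at e₃
  rw [h₄] at e₄
  rw [h₅] at e₅
  simp only [map_add, map_sub, map_neg, map_smul, smul_eq_mul] at e₁ e₂ e₃ e₄ e₅
  linear_combination e₅ + t * e₄ + t ^ 2 * e₃ + t ^ 3 * e₂ + t ^ 4 * e₁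

end DifferentialModule

lemma gseDensity_eq (M : ℕ) :
    gseDensity (M + 1) = fun x =>
      (Bconst (M + 1))⁻¹ * hermiteComb (2 * M + 1) (densityCoeff (2 * M + 1)) x := by
  funext x
  rw [hermiteComb_densityCoeff]
  rfl

/-- The GSE exponential generating function is well defined (the integral
converges for every real `t`), is smooth, and satisfies the fourth order ODE
`tu'''' + 5u''' − t((5/4)t²+8N+2)u'' − (9t²+20N+5)u'
  + t((1/4)t⁴+5(N+1/4)t²+16N²+8N−11)u = 0`. -/
theorem gseEGF_ode (N : ℕ) (hN : 1 ≤ N) :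
    (∀ t : ℝ, Integrable (fun x : ℝ => Real.exp (t * x) * gseDensity N x)) ∧
    ContDiff ℝ (⊤ : ℕ∞) (gseEGF N) ∧
    ∀ t : ℝ,
      t * iteratedDeriv 4 (gseEGF N) t + 5 * iteratedDeriv 3 (gseEGF N) t -
          t * ((5 / 4) * t ^ 2 + 8 * (N : ℝ) + 2) * iteratedDeriv 2 (gseEGF N) t -
          (9 * t ^ 2 + 20 * (N : ℝ) + 5) * deriv (gseEGF N) t +
          t * ((1 / 4) * t ^ 4 + 5 * ((N : ℝ) + 1 / 4) * t ^ 2 +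
              16 * (N : ℝ) ^ 2 + 8 * (N : ℝ) - 11) * gseEGF N t = 0 := by
  obtain ⟨M, rfl⟩ : ∃ M, N = M + 1 := ⟨N - 1, by omega⟩
  have hd : ExpIntegrable (gseDensity (M + 1)) := by
    rw [gseDensity_eq]
    exact (expIntegrable_hermiteComb _ _).const_mul _
  refine ⟨hd, hd.contDiff_expTransform, fun t => ?_⟩
  have hu : gseEGF (M + 1) = fun s => (Bconst (M + 1))⁻¹ *
      hermiteTransform (2 * M + 1) s (densityCoeff (2 * M + 1)) := by
    funext s
    change expTransform (gseDensity (M + 1)) s = _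
    rw [gseDensity_eq, expTransform_const_mul]
    rfl
  have hj (j : ℕ) : iteratedDeriv j (gseEGF (M + 1)) t = (Bconst (M + 1))⁻¹ *
      hermiteTransform (2 * M + 1) t
        ((Polynomial.X ^ j : Polynomial ℝ) • densityCoeff (2 * M + 1)) := by
    rw [hu, iteratedDeriv_const_mul_field, iteratedDeriv_hermiteTransform]
  rw [← iteratedDeriv_one, hj 4, hj 3, hj 2, hj 1, hu, pow_one]
  have h := hermiteTransform_ode (2 * M + 1) t
  push_cast at h ⊢
  linear_combination (Bconst (M + 1))⁻¹ / 4 * h
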